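/- In the counterexample market with parameter n, there exists n₀ ∈ ℕ such that for every n ≥ n₀: an optimal strategy for the transaction-cost problem exists (i.e. a liquidating self-financing strategy attaining J with φ⁰_2 > 0 a.s.), and every optimal strategy satisfies φ_0 = 0 a.s. (the initial short position of one share is closed at time 0 and no risky position is held over the first period) and φ_1 < 0 a.s. (a short position is built at time 1 in every state). -/

import Mathlib

open MeasureTheory ENNReal Filter

noncomputable section

/-- Sample space of the counterexample market: first coordinate `k ∈ ℕ`,
second coordinate the Bernoulli outcome at time 2 (`true` = ask price jumps up). -/
abbrev Omega : Type := ℕ × Bool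

/-- `q n k = 2^{-(n+k)}` as an extended nonnegative real. -/
def q (n k : ℕ) : ℝ≥0∞ := (2 : ℝ≥0∞)⁻¹ ^ (n + k)

/-- The first-coordinate probabilities: `p 0 = 1 - 2^{-n}`, `p k = 2^{-(n+k)}` for `k ≥ 1`. -/
def pk (n : ℕ) (k : ℕ) : ℝ≥0∞ := if k = 0 then 1 - (2 : ℝ≥0∞)⁻¹ ^ n else (2 : ℝ≥0∞)⁻¹ ^ (n + k)

/-- The weight of each atom `(k, j)` of the counterexample market. -/
def w (n : ℕ) : Omega → ℝ≥0∞
  | (k, true) => pk n k * q n k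
  | (k, false) => pk n k * (1 - q n k)

/-- The probability measure of the counterexample market with parameter `n`. -/
def P (n : ℕ) : Measure Omega := Measure.sum (fun ω => w n ω • Measure.dirac ω)

/-- Ask price of the risky asset at time 1 in the state with first coordinate `k`. -/
def ask1 (k : ℕ) : ℝ := 2 + k

/-- Ask price of the risky asset at time 2. -/
def ask2 : Omega → ℝ
  | (k, true) => 3 + k
  | (_, false) => 1

/-- A (trading) strategy, given by holdings in the safe asset (`a`) and the risky asset (`b`)
at times `0,1,2`; adaptedness to the filtration (trivial at time 0, generated by the first
coordinate at time 1, everything at time 2) is encoded by the arguments of the functions. -/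
structure Strat where
  a0 : ℝ
  b0 : ℝ
  a1 : ℕ → ℝ
  b1 : ℕ → ℝ
  a2 : Omega → ℝ
  b2 : Omega → ℝ

/-- Self-financing condition with transaction costs, from pre-trade initial position
`(x0, y0)`: purchases are made at the ask price, sales at the bid price. -/
def SelfFinancingTC (x0 y0 : ℝ) (φ : Strat) : Prop :=
  (φ.a0 - x0 ≤ -(max (φ.b0 - y0) 0) * 3 + max (y0 - φ.b0) 0 * 3) ∧
  (∀ k : ℕ, φ.a1 k - φ.a0 ≤ -(max (φ.b1 k - φ.b0) 0) * ask1 k + max (φ.b0 - φ.b1 k) 0 * 2) ∧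
  (∀ ω : Omega,
    φ.a2 ω - φ.a1 ω.1 ≤ -(max (φ.b2 ω - φ.b1 ω.1) 0) * ask2 ω + max (φ.b1 ω.1 - φ.b2 ω) 0 * 1)

/-- An adapted (to the filtration of the counterexample market) real-valued price process. -/
structure PriceProc where
  s0 : ℝ
  s1 : ℕ → ℝ
  s2 : Omega → ℝ

/-- A price process valued in the bid-ask spread `[S̲, S̄]`. -/
def SpreadValued (S : PriceProc) : Prop :=
  S.s0 = 3 ∧ (∀ k : ℕ, 2 ≤ S.s1 k ∧ S.s1 k ≤ ask1 k) ∧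
    (∀ ω : Omega, 1 ≤ S.s2 ω ∧ S.s2 ω ≤ ask2 ω)

/-- Frictionless self-financing condition for the price process `S`, from pre-trade
initial position `(x0, y0)`. -/
def SelfFinancingFL (x0 y0 : ℝ) (S : PriceProc) (φ : Strat) : Prop :=
  (φ.a0 - x0 = -(φ.b0 - y0) * S.s0) ∧
  (∀ k : ℕ, φ.a1 k - φ.a0 = -(φ.b1 k - φ.b0) * S.s1 k) ∧
  (∀ ω : Omega, φ.a2 ω - φ.a1 ω.1 = -(φ.b2 ω - φ.b1 ω.1) * S.s2 ω)

/-- Expected logarithmic utility `E[log f]`, with values in the extended reals. -/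
def elog (μ : Measure Omega) (f : Omega → ℝ) : EReal :=
  ((∫⁻ ω, ENNReal.ofReal (Real.log (f ω)) ∂μ : ℝ≥0∞) : EReal) -
    ((∫⁻ ω, ENNReal.ofReal (-Real.log (f ω)) ∂μ : ℝ≥0∞) : EReal)

/-- Admissibility for the transaction-cost problem with pre-trade initial position `(4, -1)`:
self-financing, liquidating, with strictly positive terminal wealth a.s. -/
def AdmissibleTC (n : ℕ) (φ : Strat) : Prop :=
  SelfFinancingTC 4 (-1) φ ∧ (∀ ω : Omega, φ.b2 ω = 0) ∧ (∀ᵐ ω ∂(P n), 0 < φ.a2 ω)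

/-- The value `J` of the transaction-cost utility maximization problem. -/
def JTC (n : ℕ) : EReal :=
  sSup {x : EReal | ∃ φ : Strat, AdmissibleTC n φ ∧ x = elog (P n) φ.a2}

/-- Admissibility for the frictionless problem for `S` with pre-trade initial position `(4, -1)`. -/
def AdmissibleFL (n : ℕ) (S : PriceProc) (φ : Strat) : Prop :=
  SelfFinancingFL 4 (-1) S φ ∧ (∀ ω : Omega, φ.b2 ω = 0) ∧ (∀ᵐ ω ∂(P n), 0 < φ.a2 ω)

/-- The value `J(S̃)` of the frictionless utility maximization problem for the price process `S̃`. -/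
def JFL (n : ℕ) (S : PriceProc) : EReal :=
  sSup {x : EReal | ∃ φ : Strat, AdmissibleFL n S φ ∧ x = elog (P n) φ.a2}

end

section LogUtility

variable {μ : Measure Omega} {f : Omega → ℝ}

theorem integrable_of_lintegral_ofReal_ne_top {g : Omega → ℝ}
    (hpos : ∫⁻ ω, ENNReal.ofReal (g ω) ∂μ ≠ ∞)
    (hneg : ∫⁻ ω, ENNReal.ofReal (-g ω) ∂μ ≠ ∞) : Integrable g μ := by
  refine ⟨Measurable.of_discrete.aestronglyMeasurable, ?_⟩
  rw [hasFiniteIntegral_iff_norm]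
  calc ∫⁻ ω, ENNReal.ofReal ‖g ω‖ ∂μ
      ≤ ∫⁻ ω, (ENNReal.ofReal (g ω) + ENNReal.ofReal (-g ω)) ∂μ := by
        refine lintegral_mono fun ω => ?_
        rw [Real.norm_eq_abs]
        rcases abs_cases (g ω) with h | h <;> rw [h.1]
        · exact le_self_add
        · exact le_add_self
    _ = ∫⁻ ω, ENNReal.ofReal (g ω) ∂μ + ∫⁻ ω, ENNReal.ofReal (-g ω) ∂μ :=
        lintegral_add_left Measurable.of_discrete _
    _ < ∞ := ENNReal.add_lt_top.2 ⟨hpos.lt_top, hneg.lt_top⟩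

theorem elog_eq_integral (hf : Integrable (fun ω => Real.log (f ω)) μ) :
    elog μ f = ((∫ ω, Real.log (f ω) ∂μ : ℝ) : EReal) := by
  have hpos := hf.lintegral_lt_top.ne
  have hneg : ∫⁻ ω, ENNReal.ofReal (-Real.log (f ω)) ∂μ ≠ ∞ := hf.neg.lintegral_lt_top.ne
  rw [integral_eq_lintegral_pos_part_sub_lintegral_neg_part hf, EReal.coe_sub,
    EReal.coe_ennreal_toReal hpos, EReal.coe_ennreal_toReal hneg]
  rfl

theorem integrable_log_of_elog_ne_bot
    (hpos : ∫⁻ ω, ENNReal.ofReal (Real.log (f ω)) ∂μ ≠ ∞) (h : elog μ f ≠ ⊥) :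
    Integrable (fun ω => Real.log (f ω)) μ := by
  refine integrable_of_lintegral_ofReal_ne_top hpos fun hneg => h ?_
  rw [elog, hneg]
  simp

end LogUtility

/-- The conditional probability of an upward jump of the ask price, as a real number. -/
noncomputable def jumpProb (n k : ℕ) : ℝ := (2 : ℝ)⁻¹ ^ (n + k)

theorem jumpProb_pos (n k : ℕ) : 0 < jumpProb n k := by unfold jumpProb; positivity

theorem q_eq_ofReal (n k : ℕ) : q n k = ENNReal.ofReal (jumpProb n k) := by
  rw [q, jumpProb, ENNReal.ofReal_pow (by norm_num), ENNReal.ofReal_inv_of_pos (by norm_num)]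
  norm_num

theorem jumpProb_mul_lt_one {n : ℕ} (hn : 2 ≤ n) (k : ℕ) : jumpProb n k * (2 + k) < 1 := by
  have h1 : (k : ℝ) + 1 ≤ 2 ^ k := by exact_mod_cast Nat.lt_two_pow_self (n := k)
  have h2 : (2 : ℝ) ^ (2 + k) ≤ 2 ^ (n + k) := pow_le_pow_right₀ (by norm_num) (by omega)
  have h3 : (2 : ℝ) ^ (2 + k) = 4 * 2 ^ k := by ring
  have hk : (0 : ℝ) ≤ k := k.cast_nonneg
  rw [jumpProb, inv_pow, inv_mul_lt_iff₀ (by positivity)]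
  linarith

theorem jumpProb_lt_one {n : ℕ} (hn : 2 ≤ n) (k : ℕ) : jumpProb n k < 1 := by
  have := jumpProb_mul_lt_one hn k
  have := jumpProb_pos n k
  have hk : (0 : ℝ) ≤ k := k.cast_nonneg
  nlinarith

theorem one_sub_q_eq_ofReal (n k : ℕ) : 1 - q n k = ENNReal.ofReal (1 - jumpProb n k) := by
  rw [q_eq_ofReal, ENNReal.ofReal_sub _ (jumpProb_pos n k).le, ENNReal.ofReal_one]

theorem pk_ne_zero {n : ℕ} (hn : 2 ≤ n) (k : ℕ) : pk n k ≠ 0 := by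
  unfold pk
  split_ifs
  · have : (2 : ℝ≥0∞)⁻¹ ^ n < 1 := by
      refine pow_lt_one₀ (by simp) ?_ (by omega)
      simp
    exact (tsub_pos_of_lt this).ne'
  · exact pow_ne_zero _ (by simp)

theorem w_ne_zero {n : ℕ} (hn : 2 ≤ n) (ω : Omega) : w n ω ≠ 0 := by
  obtain ⟨k, _ | _⟩ := ω
  · refine mul_ne_zero (pk_ne_zero hn k) ?_
    rw [one_sub_q_eq_ofReal]
    simpa using jumpProb_lt_one hn k
  · exact mul_ne_zero (pk_ne_zero hn k) (pow_ne_zero _ (by simp))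

theorem tsum_pk_ne_top (n : ℕ) : ∑' k, pk n k ≠ ∞ := by
  refine ne_top_of_le_ne_top (b := ∑' k : ℕ, (2 : ℝ≥0∞)⁻¹ ^ k) ?_
    (ENNReal.tsum_le_tsum fun k => ?_)
  · rw [ENNReal.tsum_geometric, ENNReal.one_sub_inv_two, inv_inv]
    simp
  · unfold pk
    split_ifs with hk
    · simp [hk]
    · exact pow_le_pow_of_le_one (by simp) (by simp) (by omega)

theorem lintegral_P (n : ℕ) (f : Omega → ℝ≥0∞) :
    ∫⁻ ω, f ω ∂(P n) =
      ∑' k, pk n k * (q n k * f (k, true) + (1 - q n k) * f (k, false)) := by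
  rw [P, lintegral_sum_measure, ENNReal.tsum_prod']
  refine tsum_congr fun k => ?_
  simp only [lintegral_smul_measure, lintegral_dirac, tsum_fintype, Fintype.sum_bool, w,
    smul_eq_mul]
  ring

theorem ae_P_iff {n : ℕ} (hn : 2 ≤ n) {p : Omega → Prop} :
    (∀ᵐ ω ∂(P n), p ω) ↔ ∀ ω, p ω := by
  refine ⟨fun h ω => ?_, ae_of_all _⟩
  rw [P, Measure.ae_sum_iff] at h
  have := (Measure.ae_ennreal_smul_measure_iff (w_ne_zero hn ω)).1 (h ω)
  rwa [ae_dirac_eq, eventually_pure] at this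

instance (n : ℕ) : IsFiniteMeasure (P n) := by
  refine ⟨?_⟩
  rw [← lintegral_one, lintegral_P]
  refine lt_of_le_of_lt (ENNReal.tsum_le_tsum fun k => ?_) (tsum_pk_ne_top n).lt_top
  have hq : q n k ≤ 1 := pow_le_one₀ (by simp) (by simp)
  rw [mul_one, mul_one, add_tsub_cancel_of_le hq, mul_one]

theorem lintegral_ofReal_le {n : ℕ} (hn : 2 ≤ n) {f : Omega → ℝ} {C : ℝ}
    (hf : ∀ ω, 0 ≤ f ω)
    (h : ∀ k, jumpProb n k * f (k, true) + (1 - jumpProb n k) * f (k, false) ≤ C) :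
    ∫⁻ ω, ENNReal.ofReal (f ω) ∂(P n) ≤ ENNReal.ofReal C * P n Set.univ := by
  rw [← lintegral_const, lintegral_P, lintegral_P]
  refine ENNReal.tsum_le_tsum fun k => mul_le_mul_right ?_ _
  have h0 := (jumpProb_pos n k).le
  have h1 : 0 ≤ 1 - jumpProb n k := sub_nonneg.2 (jumpProb_lt_one hn k).le
  rw [← add_mul, one_sub_q_eq_ofReal, q_eq_ofReal, ← ENNReal.ofReal_mul h0,
    ← ENNReal.ofReal_mul h1, ← ENNReal.ofReal_add (mul_nonneg h0 (hf _)) (mul_nonneg h1 (hf _)),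
    ← ENNReal.ofReal_add h0 h1]
  simpa using ENNReal.ofReal_le_ofReal (h k)

/-- The number of shares sold short at time 1 by the optimal strategy. -/
noncomputable def optShort (n k : ℕ) : ℝ := (1 - jumpProb n k) / (1 + k) - jumpProb n k

/-- The terminal wealth of the optimal strategy. -/
noncomputable def optWealth (n : ℕ) : Omega → ℝ
  | (k, true) => jumpProb n k * (2 + k)
  | (k, false) => (1 - jumpProb n k) * (2 + k) / (1 + k)

/-- The optimal strategy: close the short position at time 0, sell `optShort` shares short at
time 1 and liquidate at time 2. -/
noncomputable def optStrat (n : ℕ) : Strat where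
  a0 := 1
  b0 := 0
  a1 k := 1 + 2 * optShort n k
  b1 k := -optShort n k
  a2 := optWealth n
  b2 _ := 0

theorem optShort_pos {n : ℕ} (hn : 2 ≤ n) (k : ℕ) : 0 < optShort n k := by
  have h := jumpProb_mul_lt_one hn k
  have hk : (0 : ℝ) ≤ k := k.cast_nonneg
  rw [optShort, sub_pos, lt_div_iff₀ (by positivity)]
  linarith

theorem optWealth_true (n k : ℕ) :
    optWealth n (k, true) = 1 - optShort n k * (1 + k) := by
  have hk : (1 + k : ℝ) ≠ 0 := by positivity
  simp only [optWealth, optShort]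
  field_simp
  ring

theorem optWealth_false (n k : ℕ) : optWealth n (k, false) = 1 + optShort n k := by
  have hk : (1 + k : ℝ) ≠ 0 := by positivity
  simp only [optWealth, optShort]
  field_simp
  ring

theorem optWealth_pos {n : ℕ} (hn : 2 ≤ n) (ω : Omega) : 0 < optWealth n ω := by
  obtain ⟨k, _ | _⟩ := ω
  · rw [optWealth_false]
    linarith [optShort_pos hn k]
  · have := jumpProb_pos n k
    simp only [optWealth]
    positivity

theorem admissibleTC_optStrat {n : ℕ} (hn : 2 ≤ n) : AdmissibleTC n (optStrat n) := by
  refine ⟨⟨?_, fun k => ?_, fun ⟨k, j⟩ => ?_⟩, fun _ => rfl, ae_of_all _ (optWealth_pos hn)⟩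
  · norm_num [optStrat]
  · have := optShort_pos hn k
    simp only [optStrat]
    rw [max_eq_right (by linarith), max_eq_left (by linarith)]
    linarith
  · have := optShort_pos hn k
    simp only [optStrat]
    rw [max_eq_left (by linarith), max_eq_right (by linarith)]
    cases j
    · rw [optWealth_false]
      simp only [ask2]
      linarith
    · rw [optWealth_true]
      simp only [ask2]
      linarith

/-- A short position held over the first period ruins the investor in state `(k, true)` for
large `k`. -/
theorem AdmissibleTC.b0_nonneg {n : ℕ} (hn : 2 ≤ n) {φ : Strat} (h : AdmissibleTC n φ) :
    0 ≤ φ.b0 := by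
  obtain ⟨⟨h0, h1, h2⟩, hb, hpos⟩ := h
  rw [ae_P_iff hn] at hpos
  by_contra! hneg
  obtain ⟨k, hk⟩ := exists_nat_gt ((1 - φ.b0) / (-φ.b0))
  rw [div_lt_iff₀ (by linarith)] at hk
  have hk0 : (0 : ℝ) ≤ k := k.cast_nonneg
  have h1 := h1 k
  have h2 := h2 (k, true)
  have hpos := hpos (k, true)
  simp only [hb, ask1, ask2, zero_sub, sub_zero] at h1 h2
  have ha : φ.a0 ≤ 1 - 3 * φ.b0 := by
    rcases le_total φ.b0 (-1) with hs | hs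
    · rw [max_eq_right (by linarith), max_eq_left (by linarith)] at h0
      linarith
    · rw [max_eq_left (by linarith), max_eq_right (by linarith)] at h0
      linarith
  rcases le_total (φ.b1 k) φ.b0 with hs | hs
  · rw [max_eq_right (by linarith), max_eq_left (by linarith)] at h1
    rw [max_eq_left (by linarith), max_eq_right (by linarith)] at h2
    nlinarith
  · rw [max_eq_left (by linarith), max_eq_right (by linarith)] at h1
    rcases le_total (φ.b1 k) 0 with hs' | hs'
    · rw [max_eq_left (by linarith), max_eq_right (by linarith)] at h2
      nlinarith
    · rw [max_eq_right (by linarith), max_eq_left (by linarith)] at h2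
      nlinarith

theorem SelfFinancingTC.a2_le {φ : Strat} (h : SelfFinancingTC 4 (-1) φ)
    (hb : ∀ ω, φ.b2 ω = 0) (h0 : 0 ≤ φ.b0) (k : ℕ) :
    φ.a2 (k, true) ≤ 1 - φ.b0 - max (-φ.b1 k) 0 * (1 + k) ∧
      φ.a2 (k, false) ≤ 1 - φ.b0 + max (-φ.b1 k) 0 := by
  obtain ⟨ha, h1, h2⟩ := h
  have hk0 : (0 : ℝ) ≤ k := k.cast_nonneg
  have h1 := h1 k
  have ht := h2 (k, true)
  have hf := h2 (k, false)
  simp only [hb, ask1, ask2, zero_sub, sub_zero] at h1 ht hf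
  rw [max_eq_left (by linarith), max_eq_right (by linarith)] at ha
  rcases le_total (φ.b1 k) 0 with hs | hs
  · rw [max_eq_right (by linarith), max_eq_left (by linarith)] at h1
    rw [max_eq_left (by linarith), max_eq_right (by linarith)] at ht hf
    rw [max_eq_left (by linarith)]
    constructor <;> linarith
  · rw [max_eq_right (by linarith), max_eq_left (by linarith)] at ht hf
    rw [max_eq_right (by linarith)]
    rcases le_total (φ.b1 k) φ.b0 with hs' | hs'
    · rw [max_eq_right (by linarith), max_eq_left (by linarith)] at h1
      constructor <;> linarith
    · rw [max_eq_left (by linarith), max_eq_right (by linarith)] at h1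
      constructor <;> nlinarith

theorem AdmissibleTC.a2_le_two {n : ℕ} (hn : 2 ≤ n) {φ : Strat} (h : AdmissibleTC n φ)
    (ω : Omega) : φ.a2 ω ≤ 2 := by
  have h0 := h.b0_nonneg hn
  obtain ⟨k, j⟩ := ω
  obtain ⟨ht, hf⟩ := h.1.a2_le h.2.1 h0 k
  have hpos := (ae_P_iff hn).1 h.2.2 (k, true)
  have hc := le_max_right (-φ.b1 k) 0
  have hk0 : (0 : ℝ) ≤ k := k.cast_nonneg
  cases j <;> nlinarith [mul_nonneg hc hk0]

theorem AdmissibleTC.lintegral_ofReal_log_ne_top {n : ℕ} (hn : 2 ≤ n) {φ : Strat}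
    (h : AdmissibleTC n φ) : ∫⁻ ω, ENNReal.ofReal (Real.log (φ.a2 ω)) ∂(P n) ≠ ∞ := by
  refine ne_top_of_le_ne_top (b := ∫⁻ _, ENNReal.ofReal 1 ∂(P n)) ?_
    (lintegral_mono fun ω => ENNReal.ofReal_le_ofReal ?_)
  · rw [lintegral_const]
    exact ENNReal.mul_ne_top (by simp) (measure_ne_top _ _)
  · have := Real.log_le_sub_one_of_pos ((ae_P_iff hn).1 h.2.2 ω)
    have := h.a2_le_two hn ω
    linarith

/-- The reciprocal of the optimal wealth is a supermartingale deflator for admissible wealth. -/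
theorem AdmissibleTC.expectation_div_optWealth_le {n : ℕ} (hn : 2 ≤ n) {φ : Strat}
    (h : AdmissibleTC n φ) (k : ℕ) :
    jumpProb n k * (φ.a2 (k, true) / optWealth n (k, true)) +
      (1 - jumpProb n k) * (φ.a2 (k, false) / optWealth n (k, false)) ≤ 1 - φ.b0 := by
  obtain ⟨ht, hf⟩ := h.1.a2_le h.2.1 (h.b0_nonneg hn) k
  have hq := (jumpProb_pos n k).ne'
  have hq' : 1 - jumpProb n k ≠ 0 := (sub_pos.2 (jumpProb_lt_one hn k)).ne'
  have hk : (0 : ℝ) ≤ k := k.cast_nonneg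
  have e : jumpProb n k * (φ.a2 (k, true) / optWealth n (k, true)) +
      (1 - jumpProb n k) * (φ.a2 (k, false) / optWealth n (k, false)) =
      (φ.a2 (k, true) + φ.a2 (k, false) * (1 + k)) / (2 + k) := by
    simp only [optWealth]
    field_simp
  rw [e, div_le_iff₀ (by positivity)]
  nlinarith

theorem integrable_log_optWealth {n : ℕ} (hn : 2 ≤ n) :
    Integrable (fun ω => Real.log (optWealth n ω)) (P n) := by
  refine integrable_of_lintegral_ofReal_ne_top
    ((admissibleTC_optStrat hn).lintegral_ofReal_log_ne_top hn) ?_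
  refine ne_top_of_le_ne_top (b := ENNReal.ofReal 1 * P n Set.univ)
    (ENNReal.mul_ne_top (by simp) (measure_ne_top _ _)) ?_
  refine (lintegral_mono fun ω => ENNReal.ofReal_le_ofReal ?_).trans
    (lintegral_ofReal_le hn (f := fun ω => (optWealth n ω)⁻¹)
      (fun ω => (inv_pos.2 (optWealth_pos hn ω)).le) fun k => ?_)
  · have := Real.one_sub_inv_le_log_of_pos (optWealth_pos hn ω)
    linarith
  · have hq := (jumpProb_pos n k).ne'
    have hq' : 1 - jumpProb n k ≠ 0 := (sub_pos.2 (jumpProb_lt_one hn k)).ne'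
    have hk : (0 : ℝ) ≤ k := k.cast_nonneg
    refine le_of_eq ?_
    simp only [optWealth]
    field_simp
    ring

theorem sub_one_sub_log_sub_log_nonneg {x y : ℝ} (hx : 0 < x) (hy : 0 < y) :
    0 ≤ y / x - 1 - (Real.log y - Real.log x) := by
  rw [← Real.log_div hy.ne' hx.ne']
  linarith [Real.log_le_sub_one_of_pos (div_pos hy hx)]

theorem eq_of_sub_one_sub_log_sub_log_eq_zero {x y : ℝ} (hx : 0 < x) (hy : 0 < y)
    (h : y / x - 1 - (Real.log y - Real.log x) = 0) : y = x := by
  by_contra hne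
  rw [← Real.log_div hy.ne' hx.ne'] at h
  have := Real.log_lt_sub_one_of_pos (div_pos hy hx) (by rwa [ne_eq, div_eq_one_iff_eq hx.ne'])
  linarith

theorem AdmissibleTC.integrable_div_optWealth {n : ℕ} (hn : 2 ≤ n) {φ : Strat}
    (h : AdmissibleTC n φ) : Integrable (fun ω => φ.a2 ω / optWealth n ω) (P n) ∧
      ∫ ω, φ.a2 ω / optWealth n ω ∂(P n) ≤ (1 - φ.b0) * (P n).real Set.univ := by
  have hnonneg : ∀ ω, 0 ≤ φ.a2 ω / optWealth n ω := fun ω =>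
    (div_pos ((ae_P_iff hn).1 h.2.2 ω) (optWealth_pos hn ω)).le
  have hC : 0 ≤ 1 - φ.b0 := by
    refine le_trans ?_ (h.expectation_div_optWealth_le hn 0)
    exact add_nonneg (mul_nonneg (jumpProb_pos n 0).le (hnonneg _))
      (mul_nonneg (sub_nonneg.2 (jumpProb_lt_one hn 0).le) (hnonneg _))
  have hle := lintegral_ofReal_le hn hnonneg (h.expectation_div_optWealth_le hn)
  have hfin : ENNReal.ofReal (1 - φ.b0) * P n Set.univ ≠ ∞ :=
    ENNReal.mul_ne_top (by simp) (measure_ne_top _ _)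
  constructor
  · refine integrable_of_lintegral_ofReal_ne_top (ne_top_of_le_ne_top hfin hle) ?_
    simp [ENNReal.ofReal_of_nonpos (neg_nonpos.2 (hnonneg _))]
  · rw [integral_eq_lintegral_of_nonneg_ae (ae_of_all _ hnonneg)
      Measurable.of_discrete.aestronglyMeasurable]
    refine (ENNReal.toReal_mono hfin hle).trans_eq ?_
    rw [ENNReal.toReal_mul, ENNReal.toReal_ofReal hC]
    rfl

/-- The loss in expected logarithmic utility dominates the integral of the nonnegative gap
`Y / X - 1 - log (Y / X)` between terminal wealth `Y` and the optimal wealth `X`. -/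
theorem AdmissibleTC.integral_gap_le {n : ℕ} (hn : 2 ≤ n) {φ : Strat} (h : AdmissibleTC n φ)
    (hlog : Integrable (fun ω => Real.log (φ.a2 ω)) (P n)) :
    Integrable (fun ω => φ.a2 ω / optWealth n ω - 1 -
        (Real.log (φ.a2 ω) - Real.log (optWealth n ω))) (P n) ∧
      ∫ ω, (φ.a2 ω / optWealth n ω - 1 -
        (Real.log (φ.a2 ω) - Real.log (optWealth n ω))) ∂(P n) ≤
      ∫ ω, Real.log (optWealth n ω) ∂(P n) - ∫ ω, Real.log (φ.a2 ω) ∂(P n) -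
        φ.b0 * (P n).real Set.univ := by
  obtain ⟨h_int, hle⟩ := h.integrable_div_optWealth hn
  have hopt := integrable_log_optWealth hn
  have h1 : Integrable (fun _ : Omega => (1 : ℝ)) (P n) := integrable_const _
  refine ⟨(h_int.sub h1).sub (hlog.sub hopt), ?_⟩
  have e := integral_sub (h_int.sub h1) (hlog.sub hopt)
  simp only [Pi.sub_apply] at e
  rw [e, integral_sub h_int h1, integral_sub hlog hopt, integral_const, smul_eq_mul, mul_one]
  linarith

theorem AdmissibleTC.gap_nonneg {n : ℕ} (hn : 2 ≤ n) {φ : Strat} (h : AdmissibleTC n φ) :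
    0 ≤ fun ω => φ.a2 ω / optWealth n ω - 1 -
      (Real.log (φ.a2 ω) - Real.log (optWealth n ω)) := fun ω =>
  sub_one_sub_log_sub_log_nonneg (optWealth_pos hn ω) ((ae_P_iff hn).1 h.2.2 ω)

theorem AdmissibleTC.elog_le {n : ℕ} (hn : 2 ≤ n) {φ : Strat} (h : AdmissibleTC n φ) :
    elog (P n) φ.a2 ≤ elog (P n) (optWealth n) := by
  by_cases hbot : elog (P n) φ.a2 = ⊥
  · simp [hbot]
  have hlog := integrable_log_of_elog_ne_bot (h.lintegral_ofReal_log_ne_top hn) hbot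
  rw [elog_eq_integral hlog, elog_eq_integral (integrable_log_optWealth hn), EReal.coe_le_coe_iff]
  have hgap := (h.integral_gap_le hn hlog).2
  have h0 := integral_nonneg (μ := P n) (h.gap_nonneg hn)
  have := mul_nonneg (h.b0_nonneg hn) (measureReal_nonneg (μ := P n) (s := Set.univ))
  linarith

theorem JTC_eq {n : ℕ} (hn : 2 ≤ n) : JTC n = elog (P n) (optWealth n) := by
  refine le_antisymm (sSup_le ?_) (le_sSup ⟨optStrat n, admissibleTC_optStrat hn, rfl⟩)
  rintro _ ⟨φ, h, rfl⟩
  exact h.elog_le hn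

theorem measureReal_P_univ_pos {n : ℕ} (hn : 2 ≤ n) : 0 < (P n).real Set.univ := by
  refine ENNReal.toReal_pos (fun h0 => ?_) (measure_ne_top _ _)
  rw [Measure.measure_univ_eq_zero] at h0
  have : ∀ᵐ _ω : Omega ∂(P n), False := by simp [h0]
  exact (ae_P_iff hn).1 this (0, true)

/-- An optimal strategy does not hold the risky asset over the first period, and its terminal
wealth is the optimal one. -/
theorem AdmissibleTC.eq_optWealth {n : ℕ} (hn : 2 ≤ n) {φ : Strat} (h : AdmissibleTC n φ)
    (hopt : elog (P n) φ.a2 = elog (P n) (optWealth n)) :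
    φ.b0 = 0 ∧ ∀ ω, φ.a2 ω = optWealth n ω := by
  have hopt_log := integrable_log_optWealth hn
  have hlog : Integrable (fun ω => Real.log (φ.a2 ω)) (P n) := by
    refine integrable_log_of_elog_ne_bot (h.lintegral_ofReal_log_ne_top hn) ?_
    rw [hopt, elog_eq_integral hopt_log]
    exact EReal.coe_ne_bot _
  rw [elog_eq_integral hlog, elog_eq_integral hopt_log, EReal.coe_eq_coe_iff] at hopt
  obtain ⟨h_int, hgap⟩ := h.integral_gap_le hn hlog
  have h0 := integral_nonneg (μ := P n) (h.gap_nonneg hn)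
  have hb := h.b0_nonneg hn
  have hM := measureReal_P_univ_pos hn
  refine ⟨le_antisymm (by nlinarith) hb, ?_⟩
  have hzero := le_antisymm (by linarith [mul_nonneg hb hM.le]) h0
  have hae := (integral_eq_zero_iff_of_nonneg (h.gap_nonneg hn) h_int).1 hzero
  exact fun ω => eq_of_sub_one_sub_log_sub_log_eq_zero (optWealth_pos hn ω)
    ((ae_P_iff hn).1 h.2.2 ω) ((ae_P_iff hn).1 hae ω)

/-- for all sufficiently large `n`, an optimal strategy for the transaction-cost
problem exists, and every optimal strategy holds no risky position over the first period
(`φ_0 = 0` a.s., i.e. the initial short position is closed at time 0) and builds a short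
position at time 1 in every state (`φ_1 < 0` a.s.). -/
theorem stmt_1 :
    ∃ n₀ : ℕ, ∀ n : ℕ, n₀ ≤ n →
      (∃ φ : Strat, AdmissibleTC n φ ∧ elog (P n) φ.a2 = JTC n) ∧
      (∀ φ : Strat, AdmissibleTC n φ → elog (P n) φ.a2 = JTC n →
        φ.b0 = 0 ∧ ∀ k : ℕ, φ.b1 k < 0) := by
  refine ⟨2, fun n hn => ⟨⟨optStrat n, admissibleTC_optStrat hn, (JTC_eq hn).symm⟩, ?_⟩⟩
  intro φ h hJ
  obtain ⟨hb, hX⟩ := h.eq_optWealth hn (hJ.trans (JTC_eq hn))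
  refine ⟨hb, fun k => ?_⟩
  by_contra! hk
  have hf := (h.1.a2_le h.2.1 hb.ge k).2
  rw [hX, optWealth_false, hb, max_eq_right (by linarith)] at hf
  linarith [optShort_pos hn k]
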